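/- Every real lush space is a local-GL-space: for every separable closed subspace X of a lush space E there exists a closed subspace Y of E with X ⊆ Y such that Y, with the induced norm, is a GL-space. -/

import Mathlib

open Metric Set

/-- The slice of the closed unit ball determined by a norm-one functional `f` and `ε`:
`S(f, ε) = {x ∈ B_E : f x > 1 - ε}`. -/
def glSlice {E : Type*} [NormedAddCommGroup E] [NormedSpace ℝ E]
    (f : E →L[ℝ] ℝ) (ε : ℝ) : Set E :=
  {x | ‖x‖ ≤ 1 ∧ 1 - ε < f x}

/-- A (real) Banach space is a generalized-lush space (GL-space) if for every `x` in the
unit sphere and every `ε > 0` there is a norm-one functional `f` with `x ∈ S(f, ε)` and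
`dist(y, S(f, ε)) + dist(y, -S(f, ε)) < 2 + ε` for every `y` in the unit sphere. -/
def IsGLSpace (E : Type*) [NormedAddCommGroup E] [NormedSpace ℝ E] : Prop :=
  ∀ x : E, ‖x‖ = 1 → ∀ ε : ℝ, 0 < ε →
    ∃ f : E →L[ℝ] ℝ, ‖f‖ = 1 ∧ x ∈ glSlice f ε ∧
      ∀ y : E, ‖y‖ = 1 →
        infDist y (glSlice f ε) + infDist y (-(glSlice f ε)) < 2 + ε

/-- A (real) Banach space is lush if for all `x, y` in the unit sphere and `ε > 0` there is
a norm-one functional `f` with `x ∈ S(f, ε)` and `dist(y, aco S(f, ε)) < ε`, where in the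
real case `aco S = co (S ∪ -S)`. -/
def IsLush (E : Type*) [NormedAddCommGroup E] [NormedSpace ℝ E] : Prop :=
  ∀ x y : E, ‖x‖ = 1 → ‖y‖ = 1 → ∀ ε : ℝ, 0 < ε →
    ∃ f : E →L[ℝ] ℝ, ‖f‖ = 1 ∧ x ∈ glSlice f ε ∧
      infDist y (convexHull ℝ (glSlice f ε ∪ -(glSlice f ε))) < ε

/-- `LushWitness x y ε a b`: some functional of norm at most one is `ε`-close to one at `x`, `a`
and `b`, and `y` is `ε`-close to the segment joining `a` and `-b`, where `a` and `b` lie in the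
closed unit ball. -/
def LushWitness {E : Type*} [NormedAddCommGroup E] [NormedSpace ℝ E]
    (x y : E) (ε : ℝ) (a b : E) : Prop :=
  ‖a‖ ≤ 1 ∧ ‖b‖ ≤ 1 ∧
    (∃ f : E →L[ℝ] ℝ, ‖f‖ ≤ 1 ∧ 1 - ε < f x ∧ 1 - ε < f a ∧ 1 - ε < f b) ∧
    ∃ s t : ℝ, 0 ≤ s ∧ 0 ≤ t ∧ s + t = 1 ∧ ‖y - (s • a - t • b)‖ < ε

/-- The existence of lush witnesses for all pairs of unit vectors. -/
def HasLushWitnesses (E : Type*) [NormedAddCommGroup E] [NormedSpace ℝ E] : Prop :=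
  ∀ x y : E, ‖x‖ = 1 → ‖y‖ = 1 → ∀ ε : ℝ, 0 < ε → ∃ a b : E, LushWitness x y ε a b

section

variable {E : Type*} [NormedAddCommGroup E] [NormedSpace ℝ E]

theorem convex_glSlice (f : E →L[ℝ] ℝ) (ε : ℝ) : Convex ℝ (glSlice f ε) := by
  intro x hx y hy s t hs ht hst
  refine ⟨?_, ?_⟩
  · have h := convex_closedBall (0 : E) 1 (mem_closedBall_zero_iff.2 hx.1)
      (mem_closedBall_zero_iff.2 hy.1) hs ht hst
    exact mem_closedBall_zero_iff.1 h
  · exact (convex_Ioi (1 - ε)).is_linear_preimage f.toLinearMap.isLinear hx.2 hy.2 hs ht hst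

theorem IsLush.hasLushWitnesses (hE : IsLush E) : HasLushWitnesses E := by
  intro x y hx hy ε hε
  obtain ⟨f, hf, hxf, hyf⟩ := hE x y hx hy ε hε
  have hne : (glSlice f ε).Nonempty := ⟨x, hxf⟩
  obtain ⟨z, hz, hyz⟩ := (infDist_lt_iff (hne.inl.convexHull (𝕜 := ℝ))).1 hyf
  rw [convexHull_union hne hne.neg, (convex_glSlice f ε).convexHull_eq,
    (convex_glSlice f ε).neg.convexHull_eq, mem_convexJoin] at hz
  obtain ⟨a, ha, b, hb, s, t, hs, ht, hst, rfl⟩ := hz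
  refine ⟨a, -b, ha.1, hb.1, ⟨f, hf.le, hxf.2, ha.2, hb.2⟩, s, t, hs, ht, hst, ?_⟩
  rwa [smul_neg, sub_neg_eq_add, ← dist_eq_norm]

theorem ContinuousLinearMap.le_one_of_norm_le_one {f : E →L[ℝ] ℝ} (hf : ‖f‖ ≤ 1) {x : E}
    (hx : ‖x‖ ≤ 1) : f x ≤ 1 :=
  (le_abs_self _).trans ((f.le_of_opNorm_le_of_le hf hx).trans (mul_one 1).le)

theorem LushWitness.perturb {x y x' y' a b : E} {ε δ : ℝ} (h : LushWitness x y ε a b)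
    (hx : ‖x - x'‖ ≤ δ) (hy : ‖y - y'‖ ≤ δ) : LushWitness x' y' (ε + δ) a b := by
  obtain ⟨ha, hb, ⟨f, hf, hfx, hfa, hfb⟩, s, t, hs, ht, hst, hd⟩ := h
  have hδ : 0 ≤ δ := (norm_nonneg _).trans hx
  refine ⟨ha, hb, ⟨f, hf, ?_, by linarith, by linarith⟩, s, t, hs, ht, hst, ?_⟩
  · have h1 : f (x - x') ≤ δ := by
      have h2 := (le_abs_self _).trans (f.le_of_opNorm_le_of_le hf hx)
      linarith
    rw [map_sub] at h1
    linarith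
  · have h1 : y' - (s • a - t • b) = (y - (s • a - t • b)) - (y - y') := by abel
    rw [h1]
    exact (norm_sub_le _ _).trans_lt (add_lt_add_of_lt_of_le hd hy)

/-- A countable set is contained in a countable set stable under countably many binary
operations. -/
theorem exists_countable_superset_stable {α ι : Type*} [Countable ι] (op : ι → α → α → α)
    {s : Set α} (hs : s.Countable) :
    ∃ D : Set α, s ⊆ D ∧ D.Countable ∧ ∀ i, ∀ x ∈ D, ∀ y ∈ D, op i x y ∈ D := by
  let step : Set α → Set α := fun t => t ∪ ⋃ i, image2 (op i) t t
  let A : ℕ → Set α := fun n => step^[n] s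
  have hsucc : ∀ n, A (n + 1) = step (A n) := fun n => Function.iterate_succ_apply' step n s
  have hmono : Monotone A := monotone_nat_of_le_succ fun n => by
    rw [hsucc]
    exact subset_union_left
  have hcount : ∀ n, (A n).Countable := by
    intro n
    induction n with
    | zero => exact hs
    | succ n ih =>
      rw [hsucc]
      exact ih.union (countable_iUnion fun i => ih.image2 ih (op i))
  refine ⟨⋃ n, A n, subset_iUnion A 0, countable_iUnion hcount, ?_⟩
  intro i x hx y hy
  obtain ⟨m, hm⟩ := mem_iUnion.1 hx
  obtain ⟨n, hn⟩ := mem_iUnion.1 hy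
  refine mem_iUnion.2 ⟨max m n + 1, ?_⟩
  rw [hsucc]
  exact Or.inr (mem_iUnion.2 ⟨i, mem_image2_of_mem (hmono (le_max_left m n) hm)
    (hmono (le_max_right m n) hn)⟩)

/-- The closure of a nonempty set stable under rational linear combinations is a real subspace. -/
theorem exists_submodule_coe_eq_closure {D : Set E} (hne : D.Nonempty)
    (hD : ∀ q : ℚ, ∀ x ∈ D, ∀ y ∈ D, x + (q : ℝ) • y ∈ D) :
    ∃ Y : Submodule ℝ E, (Y : Set E) = closure D := by
  have hzero : (0 : E) ∈ D := by
    obtain ⟨x, hx⟩ := hne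
    simpa using hD (-1) x hx x hx
  refine ⟨⟨⟨⟨closure D, ?_⟩, subset_closure hzero⟩, ?_⟩, rfl⟩
  · intro x y hx hy
    exact map_mem_closure₂ continuous_add hx hy fun x hx y hy => by simpa using hD 1 x hx y hy
  · intro c x hx
    have hq : c ∈ closure (range ((↑) : ℚ → ℝ)) := Rat.denseRange_cast c
    refine map_mem_closure₂ continuous_smul hq hx ?_
    rintro _ ⟨q, rfl⟩ y hy
    simpa using hD q 0 hzero y hy

theorem HasLushWitnesses.exists_separable_superspace (hE : HasLushWitnesses E)
    (X : Submodule ℝ E) (hX : TopologicalSpace.SeparableSpace X) :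
    ∃ Y : Submodule ℝ E, IsClosed (Y : Set E) ∧ X ≤ Y ∧
      TopologicalSpace.SeparableSpace Y ∧ HasLushWitnesses Y := by
  have hsel : ∀ (n : ℕ) (x y : E), ∃ a b : E, (∃ a' b', LushWitness x y (1 / (n + 1)) a' b') →
      LushWitness x y (1 / (n + 1)) a b := by
    intro n x y
    by_cases h : ∃ a' b', LushWitness x y (1 / (n + 1)) a' b'
    · obtain ⟨a, b, hab⟩ := h
      exact ⟨a, b, fun _ => hab⟩
    · exact ⟨0, 0, fun h' => absurd h' h⟩
  choose α β hαβ using hsel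
  obtain ⟨s, hs, hsX⟩ :=
    (TopologicalSpace.IsSeparable.of_separableSpace (univ : Set X)).image continuous_subtype_val
  rw [image_univ, Subtype.range_coe] at hsX
  let op : ℚ ⊕ ℕ ⊕ ℕ → E → E → E :=
    Sum.elim (fun q x y => x + (q : ℝ) • y) (Sum.elim α β)
  obtain ⟨D, hsD, hDc, hD⟩ := exists_countable_superset_stable op hs
  have hDne : D.Nonempty := (closure_nonempty_iff.1 ⟨0, hsX X.zero_mem⟩).mono hsD
  obtain ⟨Y, hY⟩ := exists_submodule_coe_eq_closure hDne fun q x hx y hy => hD (Sum.inl q) x hx y hy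
  have hDY : D ⊆ Y := hY ▸ subset_closure
  refine ⟨Y, hY ▸ isClosed_closure, fun x hx => ?_, ?_, ?_⟩
  · exact hY.ge (closure_mono hsD (hsX hx))
  · have : TopologicalSpace.IsSeparable (Y : Set E) := ⟨D, hDc, hY.le⟩
    exact this.separableSpace
  · intro x y hx hy ε hε
    obtain ⟨n, hn⟩ := exists_nat_one_div_lt (half_pos hε)
    have hpos : (0 : ℝ) < 1 / (n + 1) := Nat.one_div_pos_of_nat
    obtain ⟨δ, hδ⟩ : ∃ δ : ℝ, δ + δ = 1 / (n + 1) := ⟨_, add_halves _⟩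
    have happ : ∀ z : Y, ∃ z' ∈ D, ‖(z : E) - z'‖ ≤ δ := by
      intro z
      obtain ⟨z', hz', h⟩ := Metric.mem_closure_iff.1 (hY.le z.2) δ (by linarith)
      exact ⟨z', hz', dist_eq_norm (z : E) z' ▸ h.le⟩
    obtain ⟨x', hx', hxx⟩ := happ x
    obtain ⟨y', hy', hyy⟩ := happ y
    obtain ⟨a₀, b₀, h₀⟩ := hE x y hx hy δ (by linarith)
    have h₁ := hαβ n x' y' ⟨a₀, b₀, hδ ▸ h₀.perturb hxx hyy⟩
    obtain ⟨ha, hb, ⟨f, hf, hfx, hfa, hfb⟩, u, v, hu, hv, huv, hd⟩ :=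
      h₁.perturb (by rwa [norm_sub_rev]) (by rwa [norm_sub_rev] : ‖y' - (y : E)‖ ≤ δ)
    refine ⟨⟨α n x' y', hDY (hD (Sum.inr (Sum.inl n)) x' hx' y' hy')⟩,
      ⟨β n x' y', hDY (hD (Sum.inr (Sum.inr n)) x' hx' y' hy')⟩, ha, hb,
      ⟨f.comp Y.subtypeL, ?_, ?_, ?_, ?_⟩, u, v, hu, hv, huv, ?_⟩
    · refine ContinuousLinearMap.opNorm_le_bound _ zero_le_one fun z => ?_
      exact f.le_of_opNorm_le hf z
    · exact lt_of_le_of_lt (by linarith) hfx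
    · exact lt_of_le_of_lt (by linarith) hfa
    · exact lt_of_le_of_lt (by linarith) hfb
    · exact lt_of_lt_of_le hd (by linarith)

theorem HasLushWitnesses.exists_next (hE : HasLushWitnesses E) {u y : E} (hu : ‖u‖ = 1)
    (hy : ‖y‖ = 1) {B : ℝ} (hB : 0 < B) (hB1 : B ≤ 1) :
    ∃ u' a b : E, ‖u'‖ = 1 ∧ ‖a‖ ≤ 1 ∧ ‖b‖ ≤ 1 ∧
      (∃ s t : ℝ, 0 ≤ s ∧ 0 ≤ t ∧ s + t = 1 ∧ ‖y - (s • a - t • b)‖ < B) ∧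
      ∀ f : E →L[ℝ] ℝ, ‖f‖ ≤ 1 → 1 - B / 4 ≤ f u' →
        1 - B ≤ f u ∧ 1 - 2 * B ≤ f a ∧ 1 - 2 * B ≤ f b := by
  obtain ⟨a, b, ha, hb, ⟨g, hg, hgu, hga, hgb⟩, s, t, hs, ht, hst, hd⟩ :=
    hE u y hu hy (B / 4) (by linarith)
  set v : E := (1 / 2 : ℝ) • u + (1 / 4 : ℝ) • a + (1 / 4 : ℝ) • b with hv
  have heval : ∀ f : E →L[ℝ] ℝ, f v = 1 / 2 * f u + 1 / 4 * f a + 1 / 4 * f b := by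
    intro f
    simp [hv]
  have hvnorm : 1 - B / 4 ≤ ‖v‖ := by
    have h1 := (le_abs_self _).trans (g.le_of_opNorm_le hg v)
    rw [heval g] at h1
    linarith
  have hvle : ‖v‖ ≤ 1 := by
    refine (norm_add₃_le).trans ?_
    simp only [norm_smul, Real.norm_eq_abs]
    norm_num
    linarith
  have hvpos : 0 < ‖v‖ := by linarith
  refine ⟨‖v‖⁻¹ • v, a, b, ?_, ha, hb, ⟨s, t, hs, ht, hst, by linarith⟩, ?_⟩
  · rw [norm_smul, norm_inv, norm_norm, inv_mul_cancel₀ hvpos.ne']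
  · intro f hf hfu
    have h1 : (1 - B / 4) * ‖v‖ ≤ f v := by
      rw [map_smul, smul_eq_mul, inv_mul_eq_div, le_div_iff₀ hvpos] at hfu
      exact hfu
    have h2 : 1 - B / 2 ≤ f v := by nlinarith
    rw [heval f] at h2
    have hu1 := ContinuousLinearMap.le_one_of_norm_le_one hf hu.le
    have ha1 := ContinuousLinearMap.le_one_of_norm_le_one hf ha
    have hb1 := ContinuousLinearMap.le_one_of_norm_le_one hf hb
    refine ⟨?_, ?_, ?_⟩ <;> linarith

/-- In a nested sequence of weak-star closed slices of the dual ball, some functional lies in all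
of them. -/
theorem exists_mem_all_of_nested (U : ℕ → E) (B : ℕ → ℝ) (hU : ∀ n, ‖U n‖ = 1)
    (hB : ∀ n, 0 ≤ B n)
    (h : ∀ n, ∀ f : E →L[ℝ] ℝ, ‖f‖ ≤ 1 → 1 - B (n + 1) ≤ f (U (n + 1)) → 1 - B n ≤ f (U n)) :
    ∃ f : E →L[ℝ] ℝ, ‖f‖ ≤ 1 ∧ ∀ n, 1 - B n ≤ f (U n) := by
  let K : Set (WeakDual ℝ E) := WeakDual.toStrongDual ⁻¹' closedBall 0 1
  let C : ℕ → Set (WeakDual ℝ E) := fun n => K ∩ {f | 1 - B n ≤ f (U n)}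
  have hclosed : ∀ n, IsClosed {f : WeakDual ℝ E | 1 - B n ≤ f (U n)} := fun n =>
    isClosed_le continuous_const (WeakDual.eval_continuous (U n))
  have hK : IsCompact K := WeakDual.isCompact_closedBall 0 1
  obtain ⟨f, hf⟩ := IsCompact.nonempty_iInter_of_sequence_nonempty_isCompact_isClosed C
    (fun n f hf => ⟨hf.1, h n (WeakDual.toStrongDual f) (mem_closedBall_zero_iff.1 hf.1) hf.2⟩)
    (fun n => by
      obtain ⟨g, hg, hgU⟩ := exists_dual_vector'' ℝ (U n)
      refine ⟨StrongDual.toWeakDual g, mem_closedBall_zero_iff.2 hg, ?_⟩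
      have h1 : g (U n) = 1 := by simpa [hU n] using hgU
      change 1 - B n ≤ g (U n)
      linarith [hB n])
    (hK.inter_right (hclosed 0)) (fun n => hK.isClosed.inter (hclosed n))
  rw [mem_iInter] at hf
  exact ⟨WeakDual.toStrongDual f, mem_closedBall_zero_iff.1 (hf 0).1, fun n => (hf n).2⟩

/-- A single functional works simultaneously for a sequence of unit vectors. -/
theorem HasLushWitnesses.exists_forall_seq (hE : HasLushWitnesses E) {x : E} (hx : ‖x‖ = 1)
    {y : ℕ → E} (hy : ∀ n, ‖y n‖ = 1) {ε : ℝ} (hε : 0 < ε) (hε1 : ε ≤ 1) :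
    ∃ f : E →L[ℝ] ℝ, ‖f‖ ≤ 1 ∧ 1 - ε ≤ f x ∧ ∀ n, ∃ a b : E, ‖a‖ ≤ 1 ∧ ‖b‖ ≤ 1 ∧
      1 - ε ≤ f a ∧ 1 - ε ≤ f b ∧
      ∃ s t : ℝ, 0 ≤ s ∧ 0 ≤ t ∧ s + t = 1 ∧ ‖y n - (s • a - t • b)‖ < ε := by
  let B : ℕ → ℝ := fun n => ε / 2 / 4 ^ n
  have hB : ∀ n, 0 < B n := fun n => by positivity
  have hBle : ∀ n, B n ≤ ε / 2 := fun n =>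
    div_le_self (by linarith) (one_le_pow₀ (by norm_num))
  have hBsucc : ∀ n, B (n + 1) = B n / 4 := fun n => by
    simp only [B, pow_succ]
    ring
  have hstep : ∀ (n : ℕ) (u : sphere (0 : E) 1), ∃ (u' : sphere (0 : E) 1) (a b : E),
      ‖a‖ ≤ 1 ∧ ‖b‖ ≤ 1 ∧
      (∃ s t : ℝ, 0 ≤ s ∧ 0 ≤ t ∧ s + t = 1 ∧ ‖y n - (s • a - t • b)‖ < B n) ∧
      ∀ f : E →L[ℝ] ℝ, ‖f‖ ≤ 1 → 1 - B n / 4 ≤ f u' →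
        1 - B n ≤ f u ∧ 1 - 2 * B n ≤ f a ∧ 1 - 2 * B n ≤ f b := by
    intro n u
    obtain ⟨u', a, b, hu', h⟩ := hE.exists_next (mem_sphere_zero_iff_norm.1 u.2) (hy n) (hB n)
      (by linarith [hBle n])
    exact ⟨⟨u', mem_sphere_zero_iff_norm.2 hu'⟩, a, b, h⟩
  choose next a b ha hb hd hf using hstep
  let U : ℕ → sphere (0 : E) 1 := fun n =>
    Nat.rec ⟨x, mem_sphere_zero_iff_norm.2 hx⟩ (fun n u => next n u) n
  have hnext : ∀ (n : ℕ) (f : E →L[ℝ] ℝ), ‖f‖ ≤ 1 → 1 - B (n + 1) ≤ f (U (n + 1)).1 →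
      1 - B n ≤ f (U n).1 ∧ 1 - 2 * B n ≤ f (a n (U n)) ∧ 1 - 2 * B n ≤ f (b n (U n)) := by
    intro n f hf1 hfn
    rw [hBsucc] at hfn
    exact hf n (U n) f hf1 hfn
  obtain ⟨f, hf1, hfU⟩ := exists_mem_all_of_nested (fun n => (U n).1) B
    (fun n => mem_sphere_zero_iff_norm.1 (U n).2) (fun n => (hB n).le)
    (fun n f hf1 hfn => (hnext n f hf1 hfn).1)
  refine ⟨f, hf1, ?_, fun n => ⟨a n (U n), b n (U n), ha _ _, hb _ _, ?_, ?_, ?_⟩⟩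
  · have h0 : 1 - B 0 ≤ f x := hfU 0
    linarith [hBle 0]
  · have h1 := (hnext n f hf1 (hfU (n + 1))).2.1
    linarith [hBle n]
  · have h1 := (hnext n f hf1 (hfU (n + 1))).2.2
    linarith [hBle n]
  · obtain ⟨s, t, hs, ht, hst, h⟩ := hd n (U n)
    exact ⟨s, t, hs, ht, hst, by linarith [hBle n]⟩

theorem infDist_add_infDist_neg_le {S : Set E} {a b y : E} {s t ε : ℝ} (haS : a ∈ S)
    (hbS : b ∈ S) (ha : ‖a‖ ≤ 1) (hb : ‖b‖ ≤ 1) (hs : 0 ≤ s) (ht : 0 ≤ t) (hst : s + t = 1)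
    (hy : ‖y - (s • a - t • b)‖ ≤ ε) : infDist y S + infDist y (-S) ≤ 2 + 2 * ε := by
  have hab : ‖a + b‖ ≤ 2 := (norm_add_le a b).trans (by linarith)
  have h1 : infDist y S ≤ ε + t * 2 := by
    refine (infDist_le_dist_of_mem haS).trans ?_
    have h : y - a = (y - (s • a - t • b)) - t • (a + b) := by
      rw [eq_sub_of_add_eq hst]
      module
    rw [dist_eq_norm, h]
    refine (norm_sub_le _ _).trans (add_le_add hy ?_)
    rw [norm_smul, Real.norm_of_nonneg ht]
    exact mul_le_mul_of_nonneg_left hab ht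
  have h2 : infDist y (-S) ≤ ε + s * 2 := by
    refine (infDist_le_dist_of_mem (Set.neg_mem_neg.2 hbS)).trans ?_
    have h : y - -b = (y - (s • a - t • b)) + s • (a + b) := by
      rw [eq_sub_of_add_eq' hst]
      module
    rw [dist_eq_norm, h]
    refine (norm_add_le _ _).trans (add_le_add hy ?_)
    rw [norm_smul, Real.norm_of_nonneg hs]
    exact mul_le_mul_of_nonneg_left hab hs
  linarith

theorem HasLushWitnesses.isGLSpace [TopologicalSpace.SeparableSpace E]
    (hE : HasLushWitnesses E) : IsGLSpace E := by
  intro x hx ε hε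
  obtain ⟨η, hη, hηε, hη1⟩ : ∃ η : ℝ, 0 < η ∧ η ≤ ε / 8 ∧ η ≤ 1 / 4 :=
    ⟨min (ε / 8) (1 / 4), by positivity, min_le_left _ _, min_le_right _ _⟩
  have : Nonempty (sphere (0 : E) 1) := ⟨⟨x, mem_sphere_zero_iff_norm.2 hx⟩⟩
  have : TopologicalSpace.SeparableSpace (sphere (0 : E) 1) :=
    (TopologicalSpace.IsSeparable.of_separableSpace (sphere (0 : E) 1)).separableSpace
  obtain ⟨f, hf, hfx, hfy⟩ := hE.exists_forall_seq hx
    (y := fun n => (TopologicalSpace.denseSeq (sphere (0 : E) 1) n : E))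
    (fun n => mem_sphere_zero_iff_norm.1 (Subtype.property _)) hη (by linarith)
  have hfpos : 0 < ‖f‖ := by
    have h := (le_abs_self _).trans (f.le_opNorm x)
    rw [hx, mul_one] at h
    linarith
  have hmem : ∀ z : E, ‖z‖ ≤ 1 → 1 - η ≤ f z → z ∈ glSlice (‖f‖⁻¹ • f) ε := by
    intro z hz hfz
    refine ⟨hz, ?_⟩
    have h1 : f z ≤ ‖f‖⁻¹ * f z :=
      le_mul_of_one_le_left (by linarith) ((one_le_inv₀ hfpos).2 hf)
    change 1 - ε < ‖f‖⁻¹ * f z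
    linarith
  refine ⟨‖f‖⁻¹ • f, ?_, hmem x hx.le hfx, ?_⟩
  · rw [norm_smul, norm_inv, norm_norm, inv_mul_cancel₀ hfpos.ne']
  · intro y hy
    obtain ⟨n, hn⟩ := (TopologicalSpace.denseRange_denseSeq (sphere (0 : E) 1)).exists_dist_lt
      ⟨y, mem_sphere_zero_iff_norm.2 hy⟩ hη
    obtain ⟨a, b, ha, hb, hfa, hfb, s, t, hs, ht, hst, hd⟩ := hfy n
    rw [Subtype.dist_eq, dist_eq_norm] at hn
    have hyd : ‖y - (s • a - t • b)‖ ≤ 2 * η :=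
      (norm_sub_le_norm_sub_add_norm_sub _ _ _).trans ((add_lt_add hn hd).le.trans (by linarith))
    have := infDist_add_infDist_neg_le (hmem a ha hfa) (hmem b hb hfb) ha hb hs ht hst hyd
    linarith

end

/-- Example 3.6: every lush space is a local-GL-space: every separable closed subspace of
a lush space `E` is contained in a closed subspace `Y ⊆ E` which is a GL-space (with the
induced norm). -/
theorem stmt_14 {E : Type*} [NormedAddCommGroup E] [NormedSpace ℝ E] [CompleteSpace E]
    (hE : IsLush E) :
    ∀ X : Subspace ℝ E, IsClosed (X : Set E) → TopologicalSpace.SeparableSpace X →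
      ∃ Y : Subspace ℝ E, IsClosed (Y : Set E) ∧ X ≤ Y ∧ IsGLSpace Y := by
  intro X _ hX
  obtain ⟨Y, hYc, hXY, hYs, hY⟩ := hE.hasLushWitnesses.exists_separable_superspace X hX
  exact ⟨Y, hYc, hXY, hY.isGLSpace⟩
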